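/- Let L be a finite distributive lattice and let f, g, h be functions L → L with f and g join-endomorphisms. Then h is the greatest join-endomorphism of L lying pointwise below both f and g if and only if h satisfies all of the following: (i) h(⊥) = ⊥; (ii) h(a) = f(a) ⊓ g(a) for every join-irreducible element a of L; (iii) h(a) = h(b) ⊔ h(c) for every a ∈ L and every pair of distinct elements b, c ∈ L, each of which is covered by a. -/

import Mathlib

/-- A (bottom-preserving) join-endomorphism of a lattice with bottom. -/
def IsJoinEndo {L : Type*} [Lattice L] [OrderBot L] (f : L → L) : Prop :=
  f ⊥ = ⊥ ∧ ∀ a b : L, f (a ⊔ b) = f a ⊔ f b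

section JoinEndo

variable {L : Type*}

theorem IsJoinEndo.monotone [Lattice L] [OrderBot L] {f : L → L} (hf : IsJoinEndo f) :
    Monotone f := fun a b hab => by
  rw [← sup_eq_right.mpr hab, hf.2]
  exact le_sup_left

/-- Induction on a finite lattice: every element is `⊥`, or join-irreducible, or the join of two
distinct lower covers. -/
theorem induction_supIrred_covBy [Lattice L] [OrderBot L] [Finite L] {P : L → Prop}
    (bot : P ⊥) (irred : ∀ a, SupIrred a → P a)
    (cover : ∀ a b c, b ⋖ a → c ⋖ a → b ≠ c → P b → P c → P a) (a : L) : P a := by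
  induction a using WellFoundedLT.induction with
  | ind a ih =>
    by_cases ha : SupIrred a
    · exact irred a ha
    rcases not_supIrred.mp ha with hmin | ⟨b, c, rfl, hb, hc⟩
    · rwa [hmin.eq_bot]
    obtain ⟨b', hbb', hb'⟩ := exists_le_covBy_of_lt hb
    obtain ⟨c', hcc', hc'⟩ := exists_le_covBy_of_lt hc
    refine cover _ b' c' hb' hc' ?_ (ih _ hb'.lt) (ih _ hc'.lt)
    rintro rfl
    exact hb'.lt.not_ge (sup_le hbb' hcc')

open Classical in
/-- The join of the values of `u` at the join-irreducible elements below a given element. -/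
noncomputable def supIrredExtend [Lattice L] [OrderBot L] [Fintype L] (u : L → L) (a : L) : L :=
  (Finset.univ.filter fun p => SupIrred p ∧ p ≤ a).sup u

theorem supIrredExtend_le_iff [Lattice L] [OrderBot L] [Fintype L] {u : L → L} {a x : L} :
    supIrredExtend u a ≤ x ↔ ∀ p, SupIrred p → p ≤ a → u p ≤ x := by
  simp [supIrredExtend]

theorem le_supIrredExtend [Lattice L] [OrderBot L] [Fintype L] (u : L → L) {p a : L}
    (hp : SupIrred p) (hpa : p ≤ a) : u p ≤ supIrredExtend u a :=
  supIrredExtend_le_iff.mp le_rfl p hp hpa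

theorem supIrredExtend_le [Lattice L] [OrderBot L] [Fintype L] {u f : L → L}
    (hf : Monotone f) (huf : u ≤ f) : supIrredExtend u ≤ f := fun _ =>
  supIrredExtend_le_iff.mpr fun p _ hpa => (huf p).trans (hf hpa)

theorem supIrredExtend_eq_of_supIrred [Lattice L] [OrderBot L] [Fintype L] {u : L → L}
    (hu : Monotone u) {a : L} (ha : SupIrred a) : supIrredExtend u a = u a :=
  le_antisymm (supIrredExtend_le hu le_rfl a) (le_supIrredExtend u ha le_rfl)

theorem isJoinEndo_supIrredExtend [DistribLattice L] [OrderBot L] [Fintype L] (u : L → L) :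
    IsJoinEndo (supIrredExtend u) := by
  refine ⟨le_bot_iff.mp <| supIrredExtend_le_iff.mpr fun p hp hpb =>
    (hp.ne_bot (le_bot_iff.mp hpb)).elim, fun a b => le_antisymm ?_ (sup_le ?_ ?_)⟩
  · refine supIrredExtend_le_iff.mpr fun p hp hpab => ?_
    rcases (supPrime_iff_supIrred.mpr hp).2 hpab with h | h
    · exact (le_supIrredExtend u hp h).trans le_sup_left
    · exact (le_supIrredExtend u hp h).trans le_sup_right
  · exact supIrredExtend_le_iff.mpr fun p hp h =>
      le_supIrredExtend u hp (h.trans le_sup_left)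
  · exact supIrredExtend_le_iff.mpr fun p hp h =>
      le_supIrredExtend u hp (h.trans le_sup_right)

theorem CovBy.sup_eq_of_ne [Lattice L] {a b c : L} (hb : b ⋖ a) (hc : c ⋖ a) (hbc : b ≠ c) :
    b ⊔ c = a :=
  hb.wcovBy.sup_eq hc.wcovBy hbc

theorem IsJoinEndo.le_supIrredExtend [DistribLattice L] [OrderBot L] [Fintype L] {k u : L → L}
    (hk : IsJoinEndo k) (hku : k ≤ u) : k ≤ supIrredExtend u := fun a => by
  induction a using induction_supIrred_covBy with
  | bot => exact hk.1.trans_le bot_le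
  | irred a ha => exact (hku a).trans (_root_.le_supIrredExtend u ha le_rfl)
  | cover a b c hb hc hbc ihb ihc =>
    rw [← hb.sup_eq_of_ne hc hbc, hk.2, (isJoinEndo_supIrredExtend u).2]
    exact sup_le_sup ihb ihc

theorem eq_supIrredExtend_iff [DistribLattice L] [OrderBot L] [Fintype L] {u h : L → L}
    (hu : Monotone u) :
    h = supIrredExtend u ↔ h ⊥ = ⊥ ∧ (∀ a, SupIrred a → h a = u a) ∧
      ∀ a b c, b ⋖ a → c ⋖ a → b ≠ c → h a = h b ⊔ h c := by
  have hj := isJoinEndo_supIrredExtend u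
  constructor
  · rintro rfl
    refine ⟨hj.1, fun a ha => supIrredExtend_eq_of_supIrred hu ha, fun a b c hb hc hbc => ?_⟩
    rw [← hj.2, hb.sup_eq_of_ne hc hbc]
  · rintro ⟨hbot, hirred, hcover⟩
    funext a
    induction a using induction_supIrred_covBy with
    | bot => rw [hbot, hj.1]
    | irred a ha => rw [hirred a ha, supIrredExtend_eq_of_supIrred hu ha]
    | cover a b c hb hc hbc ihb ihc =>
      rw [hcover a b c hb hc hbc, ihb, ihc, ← hj.2, hb.sup_eq_of_ne hc hbc]

end JoinEndo

theorem stmt_3 {L : Type*} [DistribLattice L] [OrderBot L] [Fintype L]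
    (f g h : L → L) (hf : IsJoinEndo f) (hg : IsJoinEndo g) :
    (IsJoinEndo h ∧ (∀ a, h a ≤ f a) ∧ (∀ a, h a ≤ g a) ∧
        ∀ k : L → L, IsJoinEndo k → (∀ a, k a ≤ f a) → (∀ a, k a ≤ g a) →
          ∀ a, k a ≤ h a) ↔
      (h ⊥ = ⊥ ∧ (∀ a : L, SupIrred a → h a = f a ⊓ g a) ∧
        ∀ a b c : L, b ⋖ a → c ⋖ a → b ≠ c → h a = h b ⊔ h c) := by
  have hj := isJoinEndo_supIrredExtend (f ⊓ g)
  have hjf : supIrredExtend (f ⊓ g) ≤ f := supIrredExtend_le hf.monotone inf_le_left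
  have hjg : supIrredExtend (f ⊓ g) ≤ g := supIrredExtend_le hg.monotone inf_le_right
  refine Iff.trans ?_ (eq_supIrredExtend_iff (u := f ⊓ g) (hf.monotone.inf hg.monotone))
  constructor
  · rintro ⟨hh, hhf, hhg, hmax⟩
    exact le_antisymm (hh.le_supIrredExtend (le_inf hhf hhg)) (hmax _ hj hjf hjg)
  · rintro rfl
    exact ⟨hj, hjf, hjg, fun k hk hkf hkg => hk.le_supIrredExtend (le_inf hkf hkg)⟩
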